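/- If q₁, q₂, q₃ ∈ (0,1) and q := q₁+q₂+q₃ < 1, then the transition matrix Q is irreducible (for all states V, V′ ∈ 𝒱 there exists t ≥ 1 with Q^t(V,V′) > 0) and aperiodic (for every state V, gcd{ t ≥ 1 : Q^t(V,V) > 0 } = 1). -/

import Mathlib

/-- Edge type of a state: backward (`b`) or forward (`f`). -/
inductive Edge : Type
  | b | f
deriving DecidableEq

instance : Fintype Edge := ⟨{Edge.b, Edge.f}, fun x => by cases x <;> simp⟩

/-- The 18-element state space `𝒱`: states `A_e^(k)` are encoded as
`Sum.inl (e, k)` and states `B_e^(kℓ)` (with `k ≠ ℓ`) as `Sum.inr (e, ⟨(k, ℓ), _⟩)`. -/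
abbrev St : Type := (Edge × Fin 3) ⊕ (Edge × {kl : Fin 3 × Fin 3 // kl.1 ≠ kl.2})

/-- The element of `{0,1,2}` different from both `k` and `l` (when `k ≠ l`). -/
def third (k l : Fin 3) : Fin 3 :=
  ⟨(6 - (k : ℕ) - (l : ℕ)) % 3, Nat.mod_lt _ (by norm_num)⟩

/-- The transition matrix `Q` with parameters `q₁ = qv 0`, `q₂ = qv 1`, `q₃ = qv 2`
(and `q = qv 0 + qv 1 + qv 2`); all entries not prescribed by the rules are `0`. -/
noncomputable def Qmat (qv : Fin 3 → ℝ) : Matrix St St ℝ :=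
  Matrix.of fun s t =>
    match s, t with
    | Sum.inl (_, k), Sum.inl (Edge.b, j) => if j = k then 0 else qv (third k j)
    | Sum.inl (_, _), Sum.inl (Edge.f, _) => 0
    | Sum.inl (_, k), Sum.inr (Edge.f, kl) =>
        if kl.1.1 = k then (1 - (qv 0 + qv 1 + qv 2)) / 2 else 0
    | Sum.inl (_, k), Sum.inr (Edge.b, kl) => if kl.1.1 = k then qv k / 2 else 0
    | Sum.inr (_, kl), Sum.inl (Edge.b, j) =>
        if j = kl.1.1 then qv (third kl.1.1 kl.1.2) else 0
    | Sum.inr (_, kl), Sum.inl (Edge.f, j) =>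
        if j = third kl.1.1 kl.1.2 then 1 - (qv 0 + qv 1 + qv 2) else 0
    | Sum.inr (_, kl), Sum.inr (Edge.b, kl') =>
        if kl'.1.1 = kl.1.1 ∧ kl'.1.2 = third kl.1.1 kl.1.2 then qv kl.1.1
        else if kl'.1.1 = kl.1.2 ∧ kl'.1.2 = third kl.1.1 kl.1.2 then qv kl.1.2
        else 0
    | Sum.inr _, Sum.inr (Edge.f, _) => 0

/-- The balanced transition matrix `Q_bal`, i.e. `Q` with `q₁ = q₂ = q₃ = q/3`. -/
noncomputable def Qbal (q : ℝ) : Matrix St St ℝ := Qmat fun _ => q / 3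

/-- The distribution `π_bal` on `𝒱`. -/
noncomputable def piBal (q : ℝ) : St → ℝ
  | Sum.inl (Edge.b, _) => q / 6
  | Sum.inl (Edge.f, _) => (1 - q) / 6
  | Sum.inr (Edge.b, _) => q / 12
  | Sum.inr (Edge.f, _) => (1 - q) / 12

lemma Matrix.pow_add_apply_pos {n : Type*} [Fintype n] [DecidableEq n] {M : Matrix n n ℝ}
    (hM : ∀ i j, 0 ≤ M i j) {s t : ℕ} {i j l : n} (hs : 0 < (M ^ s) i j)
    (ht : 0 < (M ^ t) j l) : 0 < (M ^ (s + t)) i l := by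
  rw [pow_add, Matrix.mul_apply]
  exact Finset.sum_pos'
    (fun _ _ => mul_nonneg (pow_apply_nonneg hM _ _ _) (pow_apply_nonneg hM _ _ _))
    ⟨j, Finset.mem_univ _, mul_pos hs ht⟩

section

variable {qv : Fin 3 → ℝ}

lemma Qmat_nonneg (hq0 : ∀ k, 0 < qv k) (hsum : qv 0 + qv 1 + qv 2 < 1) (V V' : St) :
    0 ≤ Qmat qv V V' := by
  have hq : ∀ k, 0 ≤ qv k := fun k => (hq0 k).le
  have hf : 0 ≤ 1 - (qv 0 + qv 1 + qv 2) := by linarith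
  rcases V with ⟨_, k⟩ | ⟨_, kl⟩ <;> rcases V' with ⟨_ | _, j⟩ | ⟨_ | _, kl'⟩ <;>
    simp only [Qmat, Matrix.of_apply] <;> (try split_ifs) <;>
    first
      | exact le_rfl
      | exact hq _
      | exact hf
      | exact div_nonneg hf zero_le_two
      | exact div_nonneg (hq _) zero_le_two

lemma Qmat_A_A_pos (hq0 : ∀ k, 0 < qv k) (e : Edge) {k j : Fin 3} (h : j ≠ k) :
    0 < Qmat qv (Sum.inl (e, k)) (Sum.inl (Edge.b, j)) := by
  simpa [Qmat, h] using hq0 _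

lemma Qmat_A_B_pos (hq0 : ∀ k, 0 < qv k) (hsum : qv 0 + qv 1 + qv 2 < 1) (e e' : Edge)
    (kl : {kl : Fin 3 × Fin 3 // kl.1 ≠ kl.2}) :
    0 < Qmat qv (Sum.inl (e, kl.1.1)) (Sum.inr (e', kl)) := by
  cases e'
  · simpa [Qmat] using hq0 _
  · simpa [Qmat] using hsum

lemma Qmat_B_Ab_pos (hq0 : ∀ k, 0 < qv k) (e : Edge)
    (kl : {kl : Fin 3 × Fin 3 // kl.1 ≠ kl.2}) :
    0 < Qmat qv (Sum.inr (e, kl)) (Sum.inl (Edge.b, kl.1.1)) := by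
  simpa [Qmat] using hq0 _

lemma Qmat_B_Af_pos (hsum : qv 0 + qv 1 + qv 2 < 1) (e : Edge)
    (kl : {kl : Fin 3 × Fin 3 // kl.1 ≠ kl.2}) :
    0 < Qmat qv (Sum.inr (e, kl)) (Sum.inl (Edge.f, third kl.1.1 kl.1.2)) := by
  simpa [Qmat] using hsum

lemma Qmat_sq_Ab_Ab_pos (hq0 : ∀ k, 0 < qv k) (hsum : qv 0 + qv 1 + qv 2 < 1)
    (k j : Fin 3) : 0 < (Qmat qv ^ 2) (Sum.inl (Edge.b, k)) (Sum.inl (Edge.b, j)) := by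
  obtain ⟨i, hik, hji⟩ : ∃ i : Fin 3, i ≠ k ∧ j ≠ i := by decide +revert
  refine Matrix.pow_add_apply_pos (s := 1) (t := 1) (Qmat_nonneg hq0 hsum)
    (j := Sum.inl (Edge.b, i)) ?_ ?_ <;> rw [pow_one]
  exacts [Qmat_A_A_pos hq0 _ hik, Qmat_A_A_pos hq0 _ hji]

lemma exists_Qmat_pos_to_Ab (hq0 : ∀ k, 0 < qv k) (V : St) :
    ∃ k, 0 < Qmat qv V (Sum.inl (Edge.b, k)) := by
  rcases V with ⟨e, k⟩ | ⟨e, kl⟩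
  · obtain ⟨j, hj⟩ := exists_ne k
    exact ⟨j, Qmat_A_A_pos hq0 e hj⟩
  · exact ⟨_, Qmat_B_Ab_pos hq0 e kl⟩

lemma exists_Qmat_sq_pos_from_Ab (hq0 : ∀ k, 0 < qv k) (hsum : qv 0 + qv 1 + qv 2 < 1)
    (V : St) : ∃ k, 0 < (Qmat qv ^ 2) (Sum.inl (Edge.b, k)) V := by
  have two_steps : ∀ {U V W : St}, 0 < Qmat qv U V → 0 < Qmat qv V W →
      0 < (Qmat qv ^ 2) U W := fun h h' =>
    Matrix.pow_add_apply_pos (s := 1) (t := 1) (Qmat_nonneg hq0 hsum)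
      (by rwa [pow_one]) (by rwa [pow_one])
  rcases V with ⟨_ | _, m⟩ | ⟨e, kl⟩
  · exact ⟨m, Qmat_sq_Ab_Ab_pos hq0 hsum m m⟩
  · obtain ⟨kl, rfl⟩ : ∃ kl : {kl : Fin 3 × Fin 3 // kl.1 ≠ kl.2},
        third kl.1.1 kl.1.2 = m := by decide +revert
    exact ⟨_, two_steps (Qmat_A_B_pos hq0 hsum _ Edge.f kl) (Qmat_B_Af_pos hsum _ kl)⟩
  · obtain ⟨j, hj⟩ := exists_ne kl.1.1
    exact ⟨j, two_steps (Qmat_A_A_pos hq0 _ hj.symm) (Qmat_A_B_pos hq0 hsum _ e kl)⟩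

lemma Qmat_pow_five_pos (hq0 : ∀ k, 0 < qv k) (hsum : qv 0 + qv 1 + qv 2 < 1)
    (V V' : St) : 0 < (Qmat qv ^ 5) V V' := by
  have hQ := Qmat_nonneg hq0 hsum
  obtain ⟨k, hk⟩ := exists_Qmat_pos_to_Ab hq0 V
  obtain ⟨j, hj⟩ := exists_Qmat_sq_pos_from_Ab hq0 hsum V'
  rw [← pow_one (Qmat qv)] at hk
  exact Matrix.pow_add_apply_pos (s := 3) (t := 2) hQ
    (Matrix.pow_add_apply_pos hQ hk (Qmat_sq_Ab_Ab_pos hq0 hsum k j)) hj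

lemma Qmat_pow_six_pos (hq0 : ∀ k, 0 < qv k) (hsum : qv 0 + qv 1 + qv 2 < 1)
    (V V' : St) : 0 < (Qmat qv ^ 6) V V' := by
  obtain ⟨k, hk⟩ := exists_Qmat_pos_to_Ab hq0 V
  rw [← pow_one (Qmat qv)] at hk
  exact Matrix.pow_add_apply_pos (s := 1) (t := 5) (Qmat_nonneg hq0 hsum) hk
    (Qmat_pow_five_pos hq0 hsum _ V')


end

/-- If `q₁, q₂, q₃ ∈ (0,1)` with `q = q₁+q₂+q₃ < 1`, then `Q` is irreducible and
aperiodic (every common divisor of the nonempty return-time set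
`{t ≥ 1 : Q^t(V,V) > 0}` equals `1`, i.e. the set's gcd is `1`). -/
theorem stmt10 (qv : Fin 3 → ℝ) (hq0 : ∀ k, 0 < qv k) (hq1 : ∀ k, qv k < 1)
    (hsum : qv 0 + qv 1 + qv 2 < 1) :
    (∀ V V' : St, ∃ t : ℕ, 1 ≤ t ∧ 0 < (Qmat qv ^ t) V V') ∧
    (∀ V : St, ∀ d : ℕ, (∀ t : ℕ, 1 ≤ t → 0 < (Qmat qv ^ t) V V → d ∣ t) → d = 1) := by
  refine ⟨fun V V' => ⟨5, by norm_num, Qmat_pow_five_pos hq0 hsum V V'⟩, fun V d hd => ?_⟩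
  have h5 := hd 5 (by norm_num) (Qmat_pow_five_pos hq0 hsum V V)
  have h6 := hd 6 (by norm_num) (Qmat_pow_six_pos hq0 hsum V V)
  simpa using Nat.dvd_sub h6 h5
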